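/- arXiv:1503.08898 — 2 statements merged into one kernel-verified Lean document; each statement's English description precedes it below -/
import Mathlib

section
/- Let P be a finite poset with |P| = m, and let x_1, x_2, …, x_m be a linear extension of P (an enumeration of P such that x_a < x_b in P implies a < b). Then rowmotion equals the composition of toggles taken in the reverse order of the linear extension, i.e. row = t_{x_1} ∘ t_{x_2} ∘ ⋯ ∘ t_{x_m} (so the toggle at the top element x_m is applied first). -/
open scoped Classical

/-- The set of order ideals (lower sets) of a poset `P`. -/
abbrev OrderIdeal (P : Type*) [PartialOrder P] := {I : Set P // IsLowerSet I}

variable {P : Type*} [PartialOrder P]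

/-- The toggle `t_p : J(P) → J(P)`: it adds `p` if `p` is a minimal element of the
complement of `I`, removes `p` if `p` is a maximal element of `I`, and otherwise fixes `I`. -/
noncomputable def toggle (p : P) (I : OrderIdeal P) : OrderIdeal P :=
  if h₁ : p ∉ I.1 ∧ ∀ q, q < p → q ∈ I.1 then
    ⟨I.1 ∪ {p}, by
      intro a b hba ha
      rcases ha with ha | ha
      · exact Or.inl (I.2 hba ha)
      · rw [Set.mem_singleton_iff] at ha
        subst ha
        rcases eq_or_lt_of_le hba with h | h
        · exact Or.inr (by rw [Set.mem_singleton_iff]; exact h)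
        · exact Or.inl (h₁.2 b h)⟩
  else if h₂ : p ∈ I.1 ∧ ∀ q, p < q → q ∉ I.1 then
    ⟨I.1 \ {p}, by
      intro a b hba ha
      refine ⟨I.2 hba ha.1, ?_⟩
      intro hb
      rw [Set.mem_singleton_iff] at hb
      subst hb
      rcases eq_or_lt_of_le hba with h | h
      · exact ha.2 (by rw [Set.mem_singleton_iff]; exact h.symm)
      · exact h₂.2 a h ha.1⟩
  else I

/-- Rowmotion: `I` is sent to the order ideal generated by the minimal elements of `P∖I`. -/
noncomputable def rowmotion (I : OrderIdeal P) : OrderIdeal P :=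
  ⟨{x | ∃ m, m ∉ I.1 ∧ (∀ q, q < m → q ∈ I.1) ∧ x ≤ m}, by
    intro a b hba ha
    obtain ⟨m, h1, h2, h3⟩ := ha
    exact ⟨m, h1, h2, hba.trans h3⟩⟩

/-- The toggleability statistic `T_p`. -/
noncomputable def togStat (p : P) (I : OrderIdeal P) : ℤ :=
  if p ∉ I.1 ∧ ∀ q, q < p → q ∈ I.1 then 1
  else if p ∈ I.1 ∧ ∀ q, p < q → q ∉ I.1 then -1
  else 0


theorem mem_toggle_self (p : P) (I : OrderIdeal P) :
    p ∈ (toggle p I).1 ↔ (p ∉ I.1 ∧ ∀ q, q < p → q ∈ I.1) ∨ (p ∈ I.1 ∧ ∃ q, p < q ∧ q ∈ I.1) := by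
  unfold toggle
  split_ifs with h₁ h₂
  · exact iff_of_true (Or.inr rfl) (Or.inl h₁)
  · have := h₂.1
    have h3 := h₂.2
    simp only [Set.mem_sdiff, Set.mem_singleton_iff, not_true_eq_false, and_false, false_iff]
    rintro (h | ⟨_, q, hq, hq'⟩)
    · exact h.1 this
    · exact h3 q hq hq'
  · push Not at h₂
    constructor
    · intro h
      exact Or.inr ⟨h, h₂ h⟩
    · rintro (h | h)
      · exact absurd h h₁
      · exact h.1

theorem mem_toggle_ne (p y : P) (hy : y ≠ p) (I : OrderIdeal P) :
    y ∈ (toggle p I).1 ↔ y ∈ I.1 := by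
  unfold toggle
  split_ifs <;> simp [hy]

theorem mem_foldr_toggle (I : OrderIdeal P) (l : List P) (hn : l.Nodup)
    (hp : l.Pairwise (fun a b => ¬ b < a)) (hu : ∀ a ∈ l, ∀ b, a < b → b ∈ l) (y : P) :
    y ∈ ((l.map toggle).foldr (· ∘ ·) id I).1 ↔
      (y ∈ l ∧ y ∈ (rowmotion I).1) ∨ (y ∉ l ∧ y ∈ I.1) := by
  induction l generalizing y with
  | nil => simp
  | cons p l ih =>
    rw [List.nodup_cons] at hn
    rw [List.pairwise_cons] at hp
    have ih' := ih hn.2 hp.2 (by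
      intro a ha b hab
      rcases List.mem_cons.1 (hu a (List.mem_cons_of_mem _ ha) b hab) with h | h
      · subst h
        exact absurd hab (hp.1 a ha)
      · exact h)
    simp only [List.map_cons, List.foldr_cons, Function.comp_apply]
    generalize (l.map toggle).foldr (· ∘ ·) id I = J at ih'
    by_cases hy : y = p
    · subst hy
      have e1 : y ∈ J.1 ↔ y ∈ I.1 := by rw [ih']; simp [hn.1]
      have e2 : ∀ q, q < y → (q ∈ J.1 ↔ q ∈ I.1) := by
        intro q hq
        have : q ∉ l := fun h => hp.1 q h hq
        rw [ih']; simp [this]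
      have e3 : ∀ q, y < q → (q ∈ J.1 ↔ q ∈ (rowmotion I).1) := by
        intro q hq
        have : q ∈ l := by
          rcases List.mem_cons.1 (hu y List.mem_cons_self q hq) with h | h
          · exact absurd h hq.ne'
          · exact h
        rw [ih']; simp [this]
      rw [mem_toggle_self, e1]
      simp only [List.mem_cons, true_or, true_and, not_true_eq_false, false_and, or_false]
      constructor
      · rintro (⟨h, h'⟩ | ⟨h, q, hq, hq'⟩)
        · exact ⟨y, h, fun q hq => (e2 q hq).1 (h' q hq), le_rfl⟩
        · exact (rowmotion I).2 hq.le ((e3 q hq).1 hq')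
      · rintro ⟨m, h1, h2, h3⟩
        by_cases hI : y ∈ I.1
        · have hlt : y < m := lt_of_le_of_ne h3 (by rintro rfl; exact h1 hI)
          exact Or.inr ⟨hI, m, hlt, (e3 m hlt).2 ⟨m, h1, h2, le_rfl⟩⟩
        · exact Or.inl ⟨hI, fun q hq => (e2 q hq).2 (h2 q (hq.trans_le h3))⟩
    · rw [mem_toggle_ne p y hy, ih']
      simp [hy]

/-- If `x 0, x 1, …, x (m-1)` is a linear extension of a finite poset `P` with `m` elements
(`x a < x b` in `P` implies `a < b`), then rowmotion equals the composition
`t_{x 0} ∘ t_{x 1} ∘ ⋯ ∘ t_{x (m-1)}`, i.e. the toggles applied in the reverse order of the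
linear extension (the toggle at the top element `x (m-1)` is applied first). -/
theorem stmt_3 [Fintype P] (m : ℕ) (hm : Fintype.card P = m)
    (x : Fin m → P) (hx : Function.Bijective x)
    (hlin : ∀ a b : Fin m, x a < x b → a < b) :
    (rowmotion : OrderIdeal P → OrderIdeal P) =
      (List.ofFn (fun a : Fin m => toggle (x a))).foldr (· ∘ ·) id := by
  funext I
  apply Subtype.ext
  ext y
  have hmap : List.ofFn (fun a : Fin m => toggle (x a)) = (List.ofFn x).map toggle := by
    rw [List.map_ofFn]; rfl
  have hall : ∀ z, z ∈ List.ofFn x := fun z => List.mem_ofFn.2 (hx.2 z)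
  rw [hmap, mem_foldr_toggle I (List.ofFn x) (List.nodup_ofFn.2 hx.1)
    (List.pairwise_ofFn.2 fun i j hij h => absurd (hlin _ _ h) hij.asymm)
    (fun _ _ b _ => hall b)]
  simp [hall y]
end

section
/- For n ≥ 2, the map sending an order ideal I ∈ J(A_n) to the (n+1)×(n+1) matrix (h_{i,j})_{0≤i,j≤n} defined by h_{i,j} = min(i+j, 2n−i−j) − 2·|I ∩ S_{i,j}| (where S_{i,j} is taken to be empty when i ∈ {0,n} or j ∈ {0,n}) is a bijection from J(A_n) to the set of height function matrices of order n. -/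
open scoped Classical

/-- Membership in the underlying set of the alternating sign matrix poset `A_n`:
triples `(i,j,k) ∈ ℤ³` with `i, j, k ≥ 0` and `i + j + k ≤ n - 2`. -/
def AMem (n : ℕ) (x : ℤ × ℤ × ℤ) : Prop :=
  0 ≤ x.1 ∧ 0 ≤ x.2.1 ∧ 0 ≤ x.2.2 ∧ x.1 + x.2.1 + x.2.2 ≤ (n : ℤ) - 2

/-- The generating covering relation of `A_n`: `ACovRel n q p` holds when `p = (i,j,k)`
covers `q`, i.e. `q` is one of `(i,j+1,k)`, `(i,j+1,k-1)`, `(i+1,j,k)`, `(i+1,j,k-1)`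
and both lie in the underlying set. -/
def ACovRel (n : ℕ) (q p : ℤ × ℤ × ℤ) : Prop :=
  AMem n q ∧ AMem n p ∧
    (q = (p.1, p.2.1 + 1, p.2.2) ∨ q = (p.1, p.2.1 + 1, p.2.2 - 1) ∨
      q = (p.1 + 1, p.2.1, p.2.2) ∨ q = (p.1 + 1, p.2.1, p.2.2 - 1))

/-- The partial order of `A_n`: the reflexive-transitive closure of the covering
relations. -/
def Ale (n : ℕ) (q p : ℤ × ℤ × ℤ) : Prop := Relation.ReflTransGen (ACovRel n) q p

/-- The strict order of `A_n`. -/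
def Alt (n : ℕ) (q p : ℤ × ℤ × ℤ) : Prop := Ale n q p ∧ q ≠ p

/-- `ACovBy n q p`: `p` covers `q` in the partial order of `A_n`, i.e. `q < p` and there
is no `r` with `q < r < p`. -/
def ACovBy (n : ℕ) (q p : ℤ × ℤ × ℤ) : Prop :=
  Alt n q p ∧ ∀ r, Alt n q r → ¬ Alt n r p

/-- The rank function `r(i,j,k) = n - 2 - i - j` on `A_n`. -/
def Arank (n : ℕ) (x : ℤ × ℤ × ℤ) : ℤ := (n : ℤ) - 2 - x.1 - x.2.1


/-- The chain `S_{i,j} = { (i-1-t, j-1-t, t) : t ∈ ℤ, t ≥ 0 } ∩ A_n`. -/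
def Sij (n : ℕ) (i j : ℤ) : Set (ℤ × ℤ × ℤ) :=
  {x | ∃ t : ℤ, 0 ≤ t ∧ x = (i - 1 - t, j - 1 - t, t)} ∩ {x | AMem n x}

/-- An order ideal of `A_n`: a set of elements of `A_n` closed downward under `Ale`. -/
def IsAIdeal (n : ℕ) (I : Set (ℤ × ℤ × ℤ)) : Prop :=
  (∀ x ∈ I, AMem n x) ∧ ∀ p ∈ I, ∀ q, Ale n q p → q ∈ I


/-- A height function matrix of order `n`: an `(n+1) × (n+1)` integer matrix with
boundary `h 0 k = h k 0 = k`, `h n k = h k n = n - k`, whose entries adjacent in a row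
or a column differ by exactly `1`. -/
def IsHeightFn (n : ℕ) (h : Fin (n + 1) → Fin (n + 1) → ℤ) : Prop :=
  (∀ k : Fin (n + 1), h 0 k = (k : ℤ) ∧ h k 0 = (k : ℤ) ∧
    h (Fin.last n) k = (n : ℤ) - (k : ℤ) ∧ h k (Fin.last n) = (n : ℤ) - (k : ℤ)) ∧
  (∀ (i : Fin (n + 1)) (j : Fin n),
    h i j.castSucc - h i j.succ = 1 ∨ h i j.succ - h i j.castSucc = 1) ∧
  (∀ (i : Fin n) (j : Fin (n + 1)),
    h i.castSucc j - h i.succ j = 1 ∨ h i.succ j - h i.castSucc j = 1)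


/-- The map from order ideals of `A_n` to `(n+1) × (n+1)` matrices given by
`h i j = min(i+j, 2n-i-j) - 2·|I ∩ S_{i,j}|` (note `S_{i,j}` is empty when `i ∈ {0,n}`
or `j ∈ {0,n}`). -/
noncomputable def heightOf (n : ℕ) (I : Set (ℤ × ℤ × ℤ)) (i j : Fin (n + 1)) : ℤ :=
  min ((i : ℤ) + (j : ℤ)) (2 * (n : ℤ) - (i : ℤ) - (j : ℤ)) -
    2 * (I ∩ Sij n (i : ℤ) (j : ℤ)).ncard

/-- Threshold of a downward closed predicate on an integer interval. -/
lemma exists_threshold (P : ℤ → Prop) (lo hi : ℤ) (h : lo ≤ hi)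
    (hP : ∀ t, lo ≤ t → t + 1 < hi → P (t + 1) → P t) :
    ∃ T, lo ≤ T ∧ T ≤ hi ∧ ∀ t, lo ≤ t → t < hi → (P t ↔ t < T) := by
  induction hi, h using Int.leInduction with
  | base => exact ⟨lo, le_rfl, le_rfl, fun t h1 h2 => by omega⟩
  | succ m hm ih =>
    obtain ⟨T, h1, h2, h3⟩ := ih (fun t a b c => hP t a (by omega) c)
    by_cases hT : T = m ∧ P m
    · refine ⟨m + 1, by omega, le_rfl, fun t a b => ?_⟩
      rcases eq_or_lt_of_le (show t ≤ m by omega) with e | e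
      · subst e
        exact ⟨fun _ => by omega, fun _ => hT.2⟩
      · rw [h3 t a e]; omega
    · refine ⟨T, h1, by omega, fun t a b => ?_⟩
      rcases eq_or_lt_of_le (show t ≤ m by omega) with e | e
      · subst e
        constructor
        · intro hp
          exfalso
          apply hT
          refine ⟨?_, hp⟩
          by_contra hne
          have h4 := hP (t - 1) (by omega) (by omega) (by simpa using hp)
          rw [h3 (t - 1) (by omega) (by omega)] at h4
          omega
        · intro; omega
      · exact h3 t a e

lemma ncard_of_threshold (n : ℕ) (I : Set (ℤ × ℤ × ℤ)) (i j T : ℤ)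
    (h1 : max 0 (i + j - n) ≤ T) (h2 : T ≤ min i j)
    (h : ∀ t, max 0 (i + j - n) ≤ t → t < min i j → ((i - 1 - t, j - 1 - t, t) ∈ I ↔ t < T)) :
    ((I ∩ Sij n i j).ncard : ℤ) = T - max 0 (i + j - n) := by
  have e : I ∩ Sij n i j = (fun t : ℤ => ((i - 1 - t, j - 1 - t, t) : ℤ × ℤ × ℤ)) ''
      (Finset.Ico (max 0 (i + j - n)) T : Finset ℤ) := by
    ext x
    simp only [Sij, AMem, Set.mem_inter_iff, Set.mem_ofPred_eq, Set.mem_image, Finset.coe_Ico,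
      Set.mem_Ico]
    constructor
    · rintro ⟨hx, ⟨t, ht, rfl⟩, hA⟩
      simp only at hA
      have a : max 0 (i + j - n) ≤ t := by omega
      exact ⟨t, ⟨a, (h t a (by omega)).1 hx⟩, rfl⟩
    · rintro ⟨t, ⟨a, b⟩, rfl⟩
      refine ⟨(h t a (by omega)).2 b, ⟨t, by omega, rfl⟩, ?_⟩
      simp only
      omega
  rw [e, Set.ncard_image_of_injective, Set.ncard_coe_finset, Int.card_Ico]
  · omega
  · intro a b hab
    simp only [Prod.mk.injEq] at hab
    exact hab.2.2

lemma heightOf_of_threshold (n : ℕ) (I : Set (ℤ × ℤ × ℤ)) (i j : Fin (n + 1)) (T : ℤ)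
    (h1 : max 0 ((i : ℤ) + j - n) ≤ T) (h2 : T ≤ min (i : ℤ) j)
    (h : ∀ t, max 0 ((i : ℤ) + j - n) ≤ t → t < min (i : ℤ) j →
      (((i : ℤ) - 1 - t, (j : ℤ) - 1 - t, t) ∈ I ↔ t < T)) :
    heightOf n I i j = i + j - 2 * T := by
  have := ncard_of_threshold n I i j T h1 h2 h
  rw [heightOf, this]
  omega

lemma ideal_cov {n : ℕ} {I : Set (ℤ × ℤ × ℤ)} (hI : IsAIdeal n I) (a b c a' b' c' : ℤ)
    (hp : (a, b, c) ∈ I) (hq : 0 ≤ a' ∧ 0 ≤ b' ∧ 0 ≤ c' ∧ a' + b' + c' ≤ (n : ℤ) - 2)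
    (h : (a' = a ∧ b' = b + 1 ∨ a' = a + 1 ∧ b' = b) ∧ (c' = c ∨ c' = c - 1)) :
    (a', b', c') ∈ I := by
  refine hI.2 _ hp _ (Relation.ReflTransGen.single ⟨hq, hI.1 _ hp, ?_⟩)
  simp only [Prod.mk.injEq]
  omega

/-- The threshold of an ideal on each chain. -/
lemma ideal_threshold {n : ℕ} {I : Set (ℤ × ℤ × ℤ)} (hI : IsAIdeal n I) (i j : Fin (n + 1)) :
    ∃ T : ℤ, max 0 ((i : ℤ) + j - n) ≤ T ∧ T ≤ min (i : ℤ) j ∧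
    (∀ t, max 0 ((i : ℤ) + j - n) ≤ t → t < min (i : ℤ) j →
      (((i : ℤ) - 1 - t, (j : ℤ) - 1 - t, t) ∈ I ↔ t < T)) ∧
    heightOf n I i j = i + j - 2 * T := by
  have hi := i.is_lt
  have hj := j.is_lt
  obtain ⟨T, h1, h2, h3⟩ := exists_threshold
    (fun t => ((i : ℤ) - 1 - t, (j : ℤ) - 1 - t, t) ∈ I) (max 0 ((i : ℤ) + j - n))
    (min (i : ℤ) j) (by omega) (by
      intro t a b hp
      have m := ideal_cov hI _ _ _ ((i : ℤ) - 1 - t) ((j : ℤ) - 1 - (t + 1)) t hp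
        (by omega) (by omega)
      exact ideal_cov hI _ _ _ _ _ _ m (by omega) (by omega))
  exact ⟨T, h1, h2, h3, heightOf_of_threshold n I i j T h1 h2 h3⟩

lemma heightOf_isHeightFn {n : ℕ} {I : Set (ℤ × ℤ × ℤ)} (hI : IsAIdeal n I) :
    IsHeightFn n (heightOf n I) := by
  refine ⟨fun k => ?_, fun i j => ?_, fun i j => ?_⟩
  · have hk := k.is_lt
    obtain ⟨T1, a1, b1, -, c1⟩ := ideal_threshold hI 0 k
    obtain ⟨T2, a2, b2, -, c2⟩ := ideal_threshold hI k 0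
    obtain ⟨T3, a3, b3, -, c3⟩ := ideal_threshold hI (Fin.last n) k
    obtain ⟨T4, a4, b4, -, c4⟩ := ideal_threshold hI k (Fin.last n)
    rw [c1, c2, c3, c4]
    simp only [Fin.val_zero, Fin.val_last] at *
    omega
  · have hi := i.is_lt
    have hj := j.is_lt
    obtain ⟨T, a1, b1, d1, c1⟩ := ideal_threshold hI i j.castSucc
    obtain ⟨T', a2, b2, d2, c2⟩ := ideal_threshold hI i j.succ
    rw [c1, c2]
    simp only [Fin.val_castSucc, Fin.val_succ, Nat.cast_add, Nat.cast_one] at *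
    have k1 : T ≤ T' := by
      by_contra hc
      have m := (d1 (T - 1) (by omega) (by omega)).2 (by omega)
      have := (d2 (T - 1) (by omega) (by omega)).1
        (ideal_cov hI _ _ _ _ _ _ m (by omega) (by omega))
      omega
    have k2 : T' ≤ T + 1 := by
      by_contra hc
      have m := (d2 (T' - 1) (by omega) (by omega)).2 (by omega)
      have := (d1 (T' - 2) (by omega) (by omega)).1
        (ideal_cov hI _ _ _ _ _ _ m (by omega) (by omega))
      omega
    omega
  · have hi := i.is_lt
    have hj := j.is_lt
    obtain ⟨T, a1, b1, d1, c1⟩ := ideal_threshold hI i.castSucc j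
    obtain ⟨T', a2, b2, d2, c2⟩ := ideal_threshold hI i.succ j
    rw [c1, c2]
    simp only [Fin.val_castSucc, Fin.val_succ, Nat.cast_add, Nat.cast_one] at *
    have k1 : T ≤ T' := by
      by_contra hc
      have m := (d1 (T - 1) (by omega) (by omega)).2 (by omega)
      have := (d2 (T - 1) (by omega) (by omega)).1
        (ideal_cov hI _ _ _ _ _ _ m (by omega) (by omega))
      omega
    have k2 : T' ≤ T + 1 := by
      by_contra hc
      have m := (d2 (T' - 1) (by omega) (by omega)).2 (by omega)
      have := (d1 (T' - 2) (by omega) (by omega)).1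
        (ideal_cov hI _ _ _ _ _ _ m (by omega) (by omega))
      omega
    omega

lemma ideal_subset {n : ℕ} {I J : Set (ℤ × ℤ × ℤ)} (hI : IsAIdeal n I) (hJ : IsAIdeal n J)
    (h : heightOf n I = heightOf n J) : I ⊆ J := by
  rintro ⟨a, b, c⟩ hx
  obtain ⟨ha, hb, hc, hs⟩ := hI.1 _ hx
  simp only at ha hb hc hs
  obtain ⟨i, hi⟩ : ∃ i : Fin (n + 1), (i : ℤ) = a + c + 1 :=
    ⟨⟨(a + c + 1).toNat, by omega⟩, by simp only; omega⟩
  obtain ⟨j, hj⟩ : ∃ j : Fin (n + 1), (j : ℤ) = b + c + 1 :=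
    ⟨⟨(b + c + 1).toNat, by omega⟩, by simp only; omega⟩
  obtain ⟨T, a1, b1, d1, c1⟩ := ideal_threshold hI i j
  obtain ⟨T', a2, b2, d2, c2⟩ := ideal_threshold hJ i j
  rw [h] at c1
  have e : ((a, b, c) : ℤ × ℤ × ℤ) = ((i : ℤ) - 1 - c, (j : ℤ) - 1 - c, c) := by
    rw [show (i : ℤ) - 1 - c = a by omega, show (j : ℤ) - 1 - c = b by omega]
  rw [e] at hx ⊢
  have hcT : c < T := (d1 c (by omega) (by omega)).1 hx
  have hTT : T = T' := by omega
  exact (d2 c (by omega) (by omega)).2 (by omega)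

/-- The threshold matrix of a height function, with natural number indices. -/
lemma heightFn_threshold {n : ℕ} {h : Fin (n + 1) → Fin (n + 1) → ℤ} (hh : IsHeightFn n h) :
    ∃ T : ℕ → ℕ → ℤ, (∀ i j : Fin (n + 1), h i j = (i : ℤ) + j - 2 * T i j) ∧
      (∀ i j, i ≤ n → j < n → T i (j + 1) = T i j ∨ T i (j + 1) = T i j + 1) ∧
      (∀ i j, i < n → j ≤ n → T (i + 1) j = T i j ∨ T (i + 1) j = T i j + 1) ∧
      (∀ i j, i ≤ n → j ≤ n → max 0 ((i : ℤ) + j - n) ≤ T i j ∧ T i j ≤ min (i : ℤ) j) := by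
  obtain ⟨hb, hr, hc⟩ := hh
  have hpar : ∀ i : Fin (n + 1), ∀ j : ℕ, ∀ hj : j < n + 1,
      ∃ t : ℤ, h i ⟨j, hj⟩ = (i : ℤ) + j - 2 * t := by
    intro i j
    induction j with
    | zero =>
      intro hj
      have := (hb i).2.1
      exact ⟨0, by simpa using this⟩
    | succ m ih =>
      intro hj
      obtain ⟨t, ht⟩ := ih (by omega)
      have := hr i ⟨m, by omega⟩
      simp only [Fin.castSucc_mk, Fin.succ_mk] at this
      rcases this with e | e
      · exact ⟨t + 1, by push_cast; omega⟩
      · exact ⟨t, by push_cast; omega⟩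
  choose f hf using hpar
  let T : ℕ → ℕ → ℤ := fun i j =>
    if hi : i < n + 1 then if hj : j < n + 1 then f ⟨i, hi⟩ j hj else 0 else 0
  have hT : ∀ i j : Fin (n + 1), h i j = (i : ℤ) + j - 2 * T i j := by
    intro i j
    have := hf i j j.is_lt
    have e : T i j = f i j j.is_lt := by simp only [T, dif_pos i.is_lt, dif_pos j.is_lt]
    rw [e]; exact this
  have hR : ∀ i j, i ≤ n → j < n → T i (j + 1) = T i j ∨ T i (j + 1) = T i j + 1 := by
    intro i j hi hj
    have := hr ⟨i, by omega⟩ ⟨j, hj⟩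
    rw [hT, hT] at this
    simp only [Fin.castSucc_mk, Fin.succ_mk] at this
    push_cast at this
    omega
  have hC : ∀ i j, i < n → j ≤ n → T (i + 1) j = T i j ∨ T (i + 1) j = T i j + 1 := by
    intro i j hi hj
    have := hc ⟨i, hi⟩ ⟨j, by omega⟩
    rw [hT, hT] at this
    simp only [Fin.castSucc_mk, Fin.succ_mk] at this
    push_cast at this
    omega
  refine ⟨T, hT, hR, hC, fun i j hi hj => ?_⟩
  have up : ∀ j, j ≤ n → 0 ≤ T i j ∧ T i j ≤ j := by
    intro j
    induction j with
    | zero =>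
      intro _
      have h1 := (hb ⟨i, by omega⟩).2.1
      rw [hT] at h1
      simp only [Fin.val_zero] at h1
      push_cast at h1 ⊢
      omega
    | succ m ih =>
      intro hm
      have := ih (by omega)
      have := hR i m hi (by omega)
      push_cast
      omega
  have dn : ∀ d, d ≤ n → T i (n - d) ≤ i ∧ (i : ℤ) - d ≤ T i (n - d) := by
    intro d
    induction d with
    | zero =>
      intro _
      have h1 := (hb ⟨i, by omega⟩).2.2.2
      rw [hT] at h1
      simp only [Fin.val_last] at h1
      simp only [Nat.sub_zero]
      push_cast at h1 ⊢
      omega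
    | succ m ih =>
      intro hm
      have h1 := ih (by omega)
      have h2 := hR i (n - (m + 1)) hi (by omega)
      rw [show n - (m + 1) + 1 = n - m by omega] at h2
      push_cast
      omega
  have h1 := up j hj
  have h2 := dn (n - j) (by omega)
  rw [show n - (n - j) = j by omega] at h2
  push_cast [hj] at h2
  omega

lemma heightOf_surj {n : ℕ} {h : Fin (n + 1) → Fin (n + 1) → ℤ} (hh : IsHeightFn n h) :
    ∃ I, IsAIdeal n I ∧ heightOf n I = h := by
  obtain ⟨T, hT, hR, hC, hB⟩ := heightFn_threshold hh
  refine ⟨{x | AMem n x ∧ x.2.2 < T (x.1 + x.2.2 + 1).toNat (x.2.1 + x.2.2 + 1).toNat},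
    ⟨fun x hx => hx.1, ?_⟩, ?_⟩
  · intro p hp q hq
    induction hq using Relation.ReflTransGen.head_induction_on with
    | refl => exact hp
    | @head q r hqr hrest ih =>
      clear hrest
      obtain ⟨hA, hA', hcov⟩ := hqr
      refine ⟨hA, ?_⟩
      obtain ⟨-, ih⟩ := ih
      obtain ⟨a, b, c⟩ := r
      simp only [AMem] at hA hA'
      replace ih : c < T (a + c + 1).toNat (b + c + 1).toNat := ih
      rcases hcov with rfl | rfl | rfl | rfl
      · simp only at hA ⊢
        have := hR (a + c + 1).toNat (b + c + 1).toNat (by omega) (by omega)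
        rw [show (b + 1 + c + 1).toNat = (b + c + 1).toNat + 1 by omega]
        omega
      · simp only at hA ⊢
        have := hC (a + c).toNat (b + c + 1).toNat (by omega) (by omega)
        rw [show (a + c).toNat + 1 = (a + c + 1).toNat by omega] at this
        rw [show a + (c - 1) + 1 = a + c by ring, show b + 1 + (c - 1) + 1 = b + c + 1 by ring]
        omega
      · simp only at hA ⊢
        have := hC (a + c + 1).toNat (b + c + 1).toNat (by omega) (by omega)
        rw [show (a + 1 + c + 1).toNat = (a + c + 1).toNat + 1 by omega]
        omega
      · simp only at hA ⊢
        have := hR (a + c + 1).toNat (b + c).toNat (by omega) (by omega)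
        rw [show (b + c).toNat + 1 = (b + c + 1).toNat by omega] at this
        rw [show b + (c - 1) + 1 = b + c by ring, show a + 1 + (c - 1) + 1 = a + c + 1 by ring]
        omega
  · funext i j
    have hi := i.is_lt
    have hj := j.is_lt
    obtain ⟨b1, b2⟩ := hB i j (by omega) (by omega)
    rw [hT]
    refine heightOf_of_threshold n _ i j (T i j) b1 b2 (fun t h1 h2 => ?_)
    simp only [AMem, Set.mem_ofPred_eq]
    rw [show ((i : ℤ) - 1 - t + t + 1).toNat = i by omega,
      show ((j : ℤ) - 1 - t + t + 1).toNat = j by omega]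
    omega

/-- For `n ≥ 2`, the map `I ↦ (min(i+j, 2n-i-j) - 2·|I ∩ S_{i,j}|)_{0 ≤ i,j ≤ n}` is a
bijection from the order ideals of `A_n` onto the height function matrices of order `n`. -/
theorem stmt_16 (n : ℕ) (hn : 2 ≤ n) :
    Set.BijOn (heightOf n) {I | IsAIdeal n I} {h | IsHeightFn n h} := by
  refine ⟨fun I hI => heightOf_isHeightFn hI, fun I hI J hJ h => ?_, fun h hh => ?_⟩
  · exact Set.Subset.antisymm (ideal_subset hI hJ h) (ideal_subset hJ hI h.symm)
  · obtain ⟨I, hI, e⟩ := heightOf_surj hh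
    exact ⟨I, hI, e⟩
end
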